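/- Let 1 ≤ p ≤ 13. There exist constants c > 0 and C > 0 such that for every polynomial η of degree ≤ p on [-1,1] with η(-1) = 0, there exists a polynomial ψ of degree ≤ p-1 on [-1,1] with ψ(1) = η(1), satisfying ∫_{-1}^{1}(η ψ - (1/4)(η - ψ)²) dx ≥ c ∫_{-1}^{1} η² dx and ∫_{-1}^{1} ψ² dx ≤ C ∫_{-1}^{1} η² dx. -/

import Mathlib

open Polynomial intervalIntegral

namespace Polynomial

/-- The integral over `[a, b]` as a linear functional on real polynomials. -/
noncomputable def intervalFunctional (a b : ℝ) : ℝ[X] →ₗ[ℝ] ℝ where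
  toFun f := ∫ x in a..b, f.eval x
  map_add' f g := by
    simp only [eval_add]
    exact intervalIntegral.integral_add (f.continuous.intervalIntegrable _ _) (g.continuous.intervalIntegrable _ _)
  map_smul' c f := by simp

theorem intervalFunctional_apply (a b : ℝ) (f : ℝ[X]) :
    intervalFunctional a b f = ∫ x in a..b, f.eval x := rfl

theorem intervalFunctional_C_mul (a b c : ℝ) (f : ℝ[X]) :
    intervalFunctional a b (C c * f) = c * intervalFunctional a b f := by
  rw [← smul_eq_C_mul, map_smul, smul_eq_mul]

theorem intervalFunctional_derivative (a b : ℝ) (f : ℝ[X]) :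
    intervalFunctional a b (derivative f) = f.eval b - f.eval a :=
  intervalIntegral.integral_eq_sub_of_hasDerivAt (fun x _ ↦ f.hasDerivAt x)
    ((derivative f).continuous.intervalIntegrable _ _)

theorem intervalFunctional_sq_nonneg {a b : ℝ} (hab : a ≤ b) (f : ℝ[X]) :
    0 ≤ intervalFunctional a b (f ^ 2) := by
  rw [intervalFunctional_apply]
  exact intervalIntegral.integral_nonneg hab fun x _ ↦ by rw [eval_pow]; positivity

/-- Integration by parts. -/
theorem intervalFunctional_derivative_mul (a b : ℝ) (f g : ℝ[X]) :
    intervalFunctional a b (derivative f * g) =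
      f.eval b * g.eval b - f.eval a * g.eval a - intervalFunctional a b (f * derivative g) := by
  have h := intervalFunctional_derivative a b (f * g)
  rw [derivative_mul, map_add, eval_mul, eval_mul] at h
  linarith

/-- Repeated integration by parts without boundary terms. -/
theorem intervalFunctional_iterate_derivative_mul (a b : ℝ) (f : ℝ[X]) (k : ℕ)
    (ha : ∀ j < k, (derivative^[j] f).eval a = 0) (hb : ∀ j < k, (derivative^[j] f).eval b = 0)
    (g : ℝ[X]) :
    intervalFunctional a b (derivative^[k] f * g) =
      (-1) ^ k * intervalFunctional a b (f * derivative^[k] g) := by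
  induction k generalizing g with
  | zero => simp
  | succ k ih =>
    rw [Function.iterate_succ_apply', intervalFunctional_derivative_mul,
      ha k k.lt_succ_self, hb k k.lt_succ_self,
      ih (fun j hj ↦ ha j (hj.trans k.lt_succ_self)) (fun j hj ↦ hb j (hj.trans k.lt_succ_self)),
      Function.iterate_succ_apply]
    ring

theorem eval_iterate_derivative_eq_zero_of_pow_dvd {f : ℝ[X]} {x : ℝ} {n j : ℕ}
    (hf : (X - C x) ^ n ∣ f) (hj : j < n) : (derivative^[j] f).eval x = 0 := by
  have h := (dvd_pow_self (X - C x) (Nat.sub_ne_zero_of_lt hj)).trans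
    (pow_sub_dvd_iterate_derivative_of_pow_dvd j hf)
  exact dvd_iff_isRoot.mp h

/-- The shifted Legendre polynomial is orthogonal on `[0, 1]` to polynomials of lower degree. -/
theorem intervalFunctional_shiftedLegendre_mul (n : ℕ) {q : ℝ[X]} (hq : q.degree < n) :
    intervalFunctional 0 1 ((shiftedLegendre n).map (Int.castRingHom ℝ) * q) = 0 := by
  have h := congrArg (map (Int.castRingHom ℝ)) (factorial_mul_shiftedLegendre_eq n)
  rw [Polynomial.map_mul, ← iterate_derivative_map] at h
  simp only [Polynomial.map_natCast, Polynomial.map_mul, Polynomial.map_pow, map_X,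
    Polynomial.map_sub, Polynomial.map_one] at h
  have h0 : (X - C (0 : ℝ)) ^ n ∣ X ^ n * (1 - X) ^ n := by simp
  have h1 : (X - C (1 : ℝ)) ^ n ∣ X ^ n * (1 - X) ^ n :=
    (pow_dvd_pow_of_dvd ⟨-1, by rw [C_1]; ring⟩ n).mul_left _
  have key := intervalFunctional_iterate_derivative_mul 0 1 (X ^ n * (1 - X) ^ n) n
    (fun j hj ↦ eval_iterate_derivative_eq_zero_of_pow_dvd h0 hj)
    (fun j hj ↦ eval_iterate_derivative_eq_zero_of_pow_dvd h1 hj) q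
  rw [← h, iterate_derivative_eq_zero_of_degree_lt hq, mul_zero, map_zero, mul_zero,
    mul_assoc, ← C_eq_natCast, intervalFunctional_C_mul] at key
  exact (mul_eq_zero.mp key).resolve_left (by exact_mod_cast n.factorial_ne_zero)

/-- The Legendre polynomial on `[-1, 1]`, normalised to take the value `1` at `1`. -/
noncomputable def legendre (n : ℕ) : ℝ[X] :=
  ((shiftedLegendre n).map (Int.castRingHom ℝ)).comp (C (1 / 2) * (1 - X))

theorem intervalFunctional_comp_half_one_sub (f : ℝ[X]) :
    intervalFunctional (-1) 1 (f.comp (C (1 / 2) * (1 - X))) = 2 * intervalFunctional 0 1 f := by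
  have h := intervalIntegral.integral_comp_sub_mul (fun x ↦ f.eval x) (a := -1) (b := 1)
    (c := (1 / 2 : ℝ)) (by norm_num) (1 / 2)
  norm_num at h
  rw [intervalFunctional_apply, intervalFunctional_apply, ← h]
  congr 1
  ext x
  simp only [eval_comp, eval_mul, eval_C, eval_sub, eval_one, eval_X]
  ring_nf

theorem natDegree_half_one_sub : (C (1 / 2 : ℝ) * (1 - X)).natDegree = 1 := by
  rw [show C (1 / 2 : ℝ) * (1 - X) = C (-1 / 2) * X + C (1 / 2) by
    rw [neg_div, C_neg]; ring]
  exact natDegree_linear (by norm_num)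

theorem natDegree_legendre (n : ℕ) : (legendre n).natDegree = n := by
  rw [legendre, natDegree_comp, natDegree_half_one_sub, mul_one,
    natDegree_map_eq_of_injective Int.cast_injective, natDegree_shiftedLegendre]

theorem intervalFunctional_legendre_mul (n : ℕ) {q : ℝ[X]} (hq : q.degree < n) :
    intervalFunctional (-1) 1 (legendre n * q) = 0 := by
  have hr : q = (q.comp (1 - C 2 * X)).comp (C (1 / 2) * (1 - X)) := by
    rw [comp_assoc]
    have : (1 - C (2 : ℝ) * X).comp (C (1 / 2) * (1 - X)) = X := by
      simp only [sub_comp, one_comp, mul_comp, C_comp, X_comp]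
      rw [← mul_assoc, ← C_mul]
      norm_num
    rw [this, comp_X]
  have hd : (q.comp (1 - C 2 * X)).degree < n := by
    rcases eq_or_ne q 0 with rfl | h0
    · simp
    have hn : q.natDegree < n := (natDegree_lt_iff_degree_lt h0).mpr hq
    have hl : (1 - C (2 : ℝ) * X).natDegree ≤ 1 := by compute_degree
    refine lt_of_le_of_lt degree_le_natDegree (Nat.cast_lt.mpr ?_)
    exact (natDegree_comp_le.trans (mul_le_of_le_one_right' hl)).trans_lt hn
  rw [hr, legendre, ← mul_comp, intervalFunctional_comp_half_one_sub,
    intervalFunctional_shiftedLegendre_mul n hd, mul_zero]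

theorem legendre_eval_one (n : ℕ) : (legendre n).eval 1 = 1 := by
  simp [legendre, eval_comp, ← coeff_zero_eq_eval_zero, coeff_shiftedLegendre]

theorem legendre_comp_neg (n : ℕ) : (legendre n).comp (-X) = C ((-1) ^ n) * legendre n := by
  refine funext fun x ↦ ?_
  have h := shiftedLegendre_eval_symm n (1 / 2 * (1 + x))
  simp only [aeval_def, ← eval_map, algebraMap_int_eq] at h
  simp only [legendre, eval_comp, eval_mul, eval_C, eval_sub, eval_one, eval_X, eval_neg,
    sub_neg_eq_add]
  rw [h]
  ring_nf

theorem legendre_eval_neg_one (n : ℕ) : (legendre n).eval (-1) = (-1) ^ n := by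
  have h := congrArg (eval 1) (legendre_comp_neg n)
  simpa [eval_comp, legendre_eval_one] using h

theorem derivative_legendre_eval_one (n : ℕ) :
    (derivative (legendre n)).eval 1 = n * (n + 1) / 2 := by
  have h : (derivative ((shiftedLegendre n).map (Int.castRingHom ℝ))).eval 0 = -(n * (n + 1)) := by
    rw [← coeff_zero_eq_eval_zero, coeff_derivative, coeff_map, coeff_shiftedLegendre]
    simp
  have hl : (derivative (C (1 / 2 : ℝ) * (1 - X))).eval 1 = -1 / 2 := by
    simp [neg_div]
  have hz : (C (1 / 2 : ℝ) * (1 - X)).eval 1 = 0 := by simp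
  rw [legendre, derivative_comp, eval_mul, eval_comp, hl, hz, h]
  ring

theorem derivative_legendre_eval_neg_one (n : ℕ) :
    (derivative (legendre n)).eval (-1) = -(-1) ^ n * (n * (n + 1) / 2) := by
  have h := congrArg (fun f ↦ (derivative f).eval 1) (legendre_comp_neg n)
  rw [derivative_comp, derivative_C_mul, eval_mul, eval_C_mul, eval_comp,
    derivative_legendre_eval_one, derivative_neg, derivative_X, eval_neg, eval_neg, eval_one,
    eval_X] at h
  linarith

theorem degree_derivative_legendre_lt (n : ℕ) : (derivative (legendre n)).degree < n := by
  rw [degree_lt_iff_coeff_zero]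
  intro m hm
  rw [coeff_derivative, coeff_eq_zero_of_natDegree_lt (by rw [natDegree_legendre]; omega), zero_mul]

theorem intervalFunctional_legendre_sq (n : ℕ) :
    intervalFunctional (-1) 1 (legendre n ^ 2) = 2 / (2 * n + 1) := by
  have hd : (X * derivative (legendre n) - C (n : ℝ) * legendre n).degree < (n : WithBot ℕ) := by
    rw [degree_lt_iff_coeff_zero]
    intro m hm
    rcases m with _ | m
    · obtain rfl : n = 0 := by omega
      simp
    rw [coeff_sub, coeff_X_mul, coeff_derivative, coeff_C_mul]
    rcases hm.eq_or_lt with rfl | hlt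
    · push_cast; ring
    · rw [coeff_eq_zero_of_natDegree_lt (by rwa [natDegree_legendre])]; ring
  have h1 := intervalFunctional_legendre_mul n hd
  have h2 := intervalFunctional_derivative (-1) 1 (X * legendre n ^ 2)
  rw [show derivative (X * legendre n ^ 2) = C (2 * n + 1 : ℝ) * legendre n ^ 2 +
      C 2 * (legendre n * (X * derivative (legendre n) - C (n : ℝ) * legendre n)) by
    simp only [derivative_mul, derivative_X, derivative_pow, C_add, C_mul, C_1]
    norm_num
    ring, map_add, intervalFunctional_C_mul, intervalFunctional_C_mul, h1] at h2
  simp [legendre_eval_one, legendre_eval_neg_one, ← pow_mul] at h2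
  field_simp
  linarith

/-- The derivative of a Legendre polynomial represents a combination of the boundary values. -/
theorem intervalFunctional_derivative_legendre_mul (n : ℕ) {q : ℝ[X]} (hq : q.degree < n + 1) :
    intervalFunctional (-1) 1 (derivative (legendre n) * q) = q.eval 1 - (-1) ^ n * q.eval (-1) := by
  have hd : (derivative q).degree < n := by
    rw [degree_lt_iff_coeff_zero]
    intro m hm
    have hm' : ((n + 1 : ℕ) : WithBot ℕ) ≤ ((m + 1 : ℕ) : WithBot ℕ) := by
      exact_mod_cast Nat.succ_le_succ hm
    rw [coeff_derivative, coeff_eq_zero_of_degree_lt (hq.trans_le (by exact_mod_cast hm')), zero_mul]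
  rw [intervalFunctional_derivative_mul, intervalFunctional_legendre_mul n hd, legendre_eval_one,
    legendre_eval_neg_one]
  ring

/-- Bessel's inequality for two orthogonal polynomials. -/
theorem intervalFunctional_bessel {a b : ℝ} (hab : a ≤ b) (f g q : ℝ[X])
    (hfg : intervalFunctional a b (f * g) = 0) :
    intervalFunctional a b (f * q) ^ 2 / intervalFunctional a b (f ^ 2) +
      intervalFunctional a b (g * q) ^ 2 / intervalFunctional a b (g ^ 2) ≤
      intervalFunctional a b (q ^ 2) := by
  set F := intervalFunctional a b (f ^ 2) with hF
  set G := intervalFunctional a b (g ^ 2) with hG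
  set u := intervalFunctional a b (f * q) with hu
  set v := intervalFunctional a b (g * q) with hv
  have h := intervalFunctional_sq_nonneg hab (q - C (u / F) * f - C (v / G) * g)
  rw [show (q - C (u / F) * f - C (v / G) * g) ^ 2 = q ^ 2 + C (u / F) * (C (u / F) * f ^ 2)
      + C (v / G) * (C (v / G) * g ^ 2) - C (2 : ℝ) * (C (u / F) * (f * q))
      - C (2 : ℝ) * (C (v / G) * (g * q)) + C (2 : ℝ) * (C (u / F) * (C (v / G) * (f * g))) by
    rw [show C (2 : ℝ) = 2 from rfl]; ring] at h
  simp only [map_add, map_sub, intervalFunctional_C_mul, hfg, ← hF, ← hG, ← hu, ← hv] at h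
  have e (x y : ℝ) : x / y * (x / y * y) = x ^ 2 / y := by
    rcases eq_or_ne y 0 with rfl | hy
    · simp
    · field_simp
  have e' (x y : ℝ) : x / y * x = x ^ 2 / y := by ring
  rw [e, e, e', e'] at h
  linarith

end Polynomial

/-- The scalar quadratic form inequality behind coercivity. It fails for `p = 14`. -/
theorem coercivity_scalar_ineq (p : ℕ) (hp1 : 1 ≤ p) (hp13 : p ≤ 13) (a s N : ℝ)
    (hdeg : p = 1 → s = 2 * a)
    (hN : s ^ 2 / (p * (p + 1)) + (s - 2 * a) ^ 2 / (p * (p - 1)) ≤ N) :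
    1 / 1000 * (a ^ 2 * (2 / (2 * p + 1)) + N) ≤
      2 * N - 1 / 4 * (a ^ 2 * (2 / (2 * p + 1))) - (3 * a - 2 * s) ^ 2 / (2 * p ^ 2) := by
  interval_cases p
  · obtain rfl := hdeg rfl
    norm_num at hN ⊢
    nlinarith [sq_nonneg a]
  all_goals
    norm_num at hN ⊢
    nlinarith [sq_nonneg (s - 2 / 3 * a), sq_nonneg a, sq_nonneg s]

theorem exists_psi_coercive_stable (p : ℕ) (hp1 : 1 ≤ p) (hp13 : p ≤ 13) :
    ∃ c > (0:ℝ), ∃ C > (0:ℝ), ∀ η : Polynomial ℝ, η.natDegree ≤ p → η.eval (-1) = 0 →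
      ∃ ψ : Polynomial ℝ, ψ.natDegree ≤ p - 1 ∧ ψ.eval 1 = η.eval 1 ∧
        (∫ x in (-1:ℝ)..1, (η.eval x * ψ.eval x - (1/4)*(η.eval x - ψ.eval x)^2))
          ≥ c * ∫ x in (-1:ℝ)..1, (η.eval x)^2 ∧
        (∫ x in (-1:ℝ)..1, (ψ.eval x)^2) ≤ C * ∫ x in (-1:ℝ)..1, (η.eval x)^2 := by
  refine ⟨1 / 1000, by norm_num, 34, by norm_num, fun η hη hη0 ↦ ?_⟩
  obtain ⟨n, rfl⟩ : ∃ n, p = n + 1 := ⟨p - 1, by omega⟩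
  have hP : (legendre (n + 1)).coeff (n + 1) ≠ 0 := by
    have h0 : legendre (n + 1) ≠ 0 := fun h ↦ by
      simpa [h] using legendre_eval_one (n + 1)
    simpa [leadingCoeff, natDegree_legendre] using leadingCoeff_ne_zero.mpr h0
  obtain ⟨a, q, hq, rfl⟩ : ∃ (a : ℝ) (q : ℝ[X]), q.degree < ((n + 1 : ℕ) : WithBot ℕ) ∧
      η = C a * legendre (n + 1) + q := by
    refine ⟨η.coeff (n + 1) / (legendre (n + 1)).coeff (n + 1),
      η - C (η.coeff (n + 1) / (legendre (n + 1)).coeff (n + 1)) * legendre (n + 1), ?_, by ring⟩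
    rw [degree_lt_iff_coeff_zero]
    intro m hm
    rw [coeff_sub, coeff_C_mul]
    rcases hm.eq_or_lt with rfl | hlt
    · rw [div_mul_cancel₀ _ hP, sub_self]
    · have hP0 : (legendre (n + 1)).coeff m = 0 :=
        coeff_eq_zero_of_natDegree_lt (by rwa [natDegree_legendre])
      rw [coeff_eq_zero_of_natDegree_lt (hη.trans_lt hlt), hP0, mul_zero, sub_zero]
  set P := legendre (n + 1) with hPdef
  set A := derivative (legendre (n + 1)) with hA
  set B := derivative (legendre n) with hB
  set s := (C a * P + q).eval 1 with hs
  have hs' : q.eval 1 = s - a := by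
    rw [hs, eval_add, eval_C_mul, legendre_eval_one]; ring
  have hq' : q.eval (-1) = (-1) ^ n * a := by
    rw [eval_add, eval_C_mul, legendre_eval_neg_one, pow_succ] at hη0; linarith
  have hsq : ((-1 : ℝ) ^ n) * (-1) ^ n = 1 := by rw [← mul_pow]; simp
  have hAd : A.degree < ((n + 1 : ℕ) : WithBot ℕ) := degree_derivative_legendre_lt (n + 1)
  have hBd : B.degree < ((n + 1 : ℕ) : WithBot ℕ) :=
    (degree_derivative_legendre_lt n).trans (by exact_mod_cast n.lt_succ_self)
  have hA' {f : ℝ[X]} (hf : f.degree < ((n + 1 : ℕ) : WithBot ℕ)) :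
      intervalFunctional (-1) 1 (A * f) = f.eval 1 + (-1) ^ n * f.eval (-1) := by
    rw [hA, intervalFunctional_derivative_legendre_mul (n + 1)
      (hf.trans (by exact_mod_cast (n + 1).lt_succ_self)), pow_succ]
    ring
  have hB' {f : ℝ[X]} (hf : f.degree < ((n + 1 : ℕ) : WithBot ℕ)) :
      intervalFunctional (-1) 1 (B * f) = f.eval 1 - (-1) ^ n * f.eval (-1) :=
    intervalFunctional_derivative_legendre_mul n (by exact_mod_cast hf)
  have hA1 : A.eval 1 = (n + 1) * (n + 2) / 2 := by
    rw [hA, derivative_legendre_eval_one]; push_cast; ring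
  have hB1 : B.eval 1 = n * (n + 1) / 2 := derivative_legendre_eval_one n
  have hA2 : A.eval (-1) = (-1) ^ n * ((n + 1) * (n + 2) / 2) := by
    rw [hA, derivative_legendre_eval_neg_one]; push_cast; ring
  have hB2 : B.eval (-1) = -(-1) ^ n * (n * (n + 1) / 2) := derivative_legendre_eval_neg_one n
  have hAq : intervalFunctional (-1) 1 (A * q) = s := by
    rw [hA' hq, hs', hq', ← mul_assoc, hsq]; ring
  have hBq : intervalFunctional (-1) 1 (B * q) = s - 2 * a := by
    rw [hB' hq, hs', hq', ← mul_assoc, hsq]; ring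
  have hAA : intervalFunctional (-1) 1 (A ^ 2) = (n + 1) * (n + 2) := by
    rw [pow_two, hA' hAd, hA1, hA2, ← mul_assoc, hsq]; ring
  have hAB : intervalFunctional (-1) 1 (A * B) = 0 := by
    rw [hA' hBd, hB1, hB2, neg_mul, mul_neg, ← mul_assoc, hsq]; ring
  have hBB : intervalFunctional (-1) 1 (B ^ 2) = n * (n + 1) := by
    rw [pow_two, hB' hBd, hB1, hB2, neg_mul, mul_neg, ← mul_assoc, hsq]; ring
  have hPP : intervalFunctional (-1) 1 (P ^ 2) = 2 / (2 * (n + 1 : ℕ) + 1) :=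
    intervalFunctional_legendre_sq (n + 1)
  have hPq {f : ℝ[X]} (hf : f.degree < ((n + 1 : ℕ) : WithBot ℕ)) :
      intervalFunctional (-1) 1 (P * f) = 0 := intervalFunctional_legendre_mul (n + 1) hf
  set N := intervalFunctional (-1) 1 (q ^ 2) with hN
  have hbessel := intervalFunctional_bessel (by norm_num : (-1 : ℝ) ≤ 1) A B q hAB
  rw [hAq, hBq, hAA, hBB] at hbessel
  have hdeg : n + 1 = 1 → s = 2 * a := by
    intro h
    obtain rfl : n = 0 := by omega
    rw [hB, derivative_of_natDegree_zero (natDegree_legendre 0), zero_mul, map_zero] at hBq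
    linarith
  have hscalar := coercivity_scalar_ineq (n + 1) hp1 hp13 a s N hdeg (by
    refine le_of_eq_of_le ?_ hbessel
    push_cast
    ring_nf)
  set κ : ℝ := (3 * a - 2 * s) / (n + 1) ^ 2 with hκ
  have hn0 : (n + 1 : ℝ) ≠ 0 := by positivity
  set ψ := C 3 * q + C κ * (A + B) with hψ
  have hψd : ψ.degree < ((n + 1 : ℕ) : WithBot ℕ) := by
    rw [degree_lt_iff_coeff_zero] at hq hAd hBd ⊢
    intro m hm
    simp [hψ, hq m hm, hAd m hm, hBd m hm]
  have hψ1 : ψ.eval 1 = s := by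
    rw [hψ, eval_add, eval_C_mul, eval_C_mul, eval_add, hA1, hB1, hs', hκ]
    field_simp
    ring
  have hηη : intervalFunctional (-1) 1 ((C a * P + q) ^ 2)
      = a ^ 2 * (2 / (2 * (n + 1 : ℕ) + 1)) + N := by
    rw [show (C a * P + q) ^ 2 = C a * (C a * P ^ 2) + C (2 * a) * (P * q) + q ^ 2 by
      rw [C_mul, show C (2 : ℝ) = 2 from rfl]; ring]
    simp only [map_add, intervalFunctional_C_mul, hPP, hPq hq, ← hN]
    ring
  have hηψ : intervalFunctional (-1) 1 ((C a * P + q) * ψ) = 3 * N + κ * (2 * s - 2 * a) := by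
    rw [show (C a * P + q) * ψ = C a * (P * ψ) + (C 3 * q ^ 2 + C κ * (A * q + B * q)) by
      rw [hψ]; ring]
    simp only [map_add, intervalFunctional_C_mul, hPq hψd, hAq, hBq, ← hN]
    ring
  have hψψ : intervalFunctional (-1) 1 (ψ ^ 2)
      = 9 * N + 6 * κ * (2 * s - 2 * a) + κ ^ 2 * (2 * (n + 1) ^ 2) := by
    rw [show ψ ^ 2 = C 9 * q ^ 2 + C 6 * (C κ * (A * q + B * q))
        + C κ * (C κ * (A ^ 2 + B ^ 2 + C 2 * (A * B))) by
      rw [hψ, show C (2 : ℝ) = 2 from rfl, show C (3 : ℝ) = 3 from rfl,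
        show C (6 : ℝ) = 6 from rfl, show C (9 : ℝ) = 9 from rfl]; ring]
    simp only [map_add, intervalFunctional_C_mul, hAA, hBB, hAB, hAq, hBq, ← hN]
    ring
  have hJ : (∫ x in (-1:ℝ)..1, ((C a * P + q).eval x * ψ.eval x
        - (1/4) * ((C a * P + q).eval x - ψ.eval x)^2))
      = 3 / 2 * intervalFunctional (-1) 1 ((C a * P + q) * ψ)
        - 1 / 4 * intervalFunctional (-1) 1 ((C a * P + q) ^ 2)
        - 1 / 4 * intervalFunctional (-1) 1 (ψ ^ 2) := by
    rw [← intervalFunctional_C_mul, ← intervalFunctional_C_mul, ← intervalFunctional_C_mul,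
      ← map_sub, ← map_sub, intervalFunctional_apply]
    congr 1
    ext x
    simp only [eval_sub, eval_mul, eval_pow, eval_C]
    ring
  have hsqη : (∫ x in (-1:ℝ)..1, ((C a * P + q).eval x)^2)
      = intervalFunctional (-1) 1 ((C a * P + q) ^ 2) := by
    simp only [intervalFunctional_apply, eval_pow]
  have hsqψ : (∫ x in (-1:ℝ)..1, (ψ.eval x)^2) = intervalFunctional (-1) 1 (ψ ^ 2) := by
    simp only [intervalFunctional_apply, eval_pow]
  have hcoer : 1 / 1000 * intervalFunctional (-1) 1 ((C a * P + q) ^ 2) ≤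
      3 / 2 * intervalFunctional (-1) 1 ((C a * P + q) * ψ)
        - 1 / 4 * intervalFunctional (-1) 1 ((C a * P + q) ^ 2)
        - 1 / 4 * intervalFunctional (-1) 1 (ψ ^ 2) := by
    rw [hψψ, hηψ, hηη]
    refine hscalar.trans_eq ?_
    have : κ ^ 2 * (2 * (n + 1) ^ 2) = 4 * ((3 * a - 2 * s) ^ 2 / (2 * (n + 1 : ℕ) ^ 2)) := by
      rw [hκ]; push_cast; field_simp; ring
    rw [this]
    ring
  refine ⟨ψ, ?_, hψ1, ?_, ?_⟩
  · rw [Nat.add_sub_cancel, natDegree_le_iff_degree_le]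
    exact Order.le_of_lt_succ (by exact_mod_cast hψd)
  · rw [hJ, hsqη]
    exact hcoer
  · rw [hsqη, hsqψ]
    have h1 := intervalFunctional_sq_nonneg (by norm_num : (-1 : ℝ) ≤ 1) (ψ - C 6 * (C a * P + q))
    rw [show (ψ - C 6 * (C a * P + q)) ^ 2 = ψ ^ 2 - C 12 * ((C a * P + q) * ψ)
        + C 36 * (C a * P + q) ^ 2 by
      rw [show C (6 : ℝ) = 6 from rfl, show C (12 : ℝ) = 12 from rfl,
        show C (36 : ℝ) = 36 from rfl]; ring,
      map_add, map_sub, intervalFunctional_C_mul, intervalFunctional_C_mul] at h1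
    have h2 := intervalFunctional_sq_nonneg (by norm_num : (-1 : ℝ) ≤ 1) (C a * P + q)
    linarith
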